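/- arXiv:1602.07446 — 2 statements merged into one kernel-verified Lean document; each statement's English description precedes it below -/
import Mathlib

section
/- Fix λ ∈ ℝ, a continuous function f : [0,1] → ℝ, and a continuous function G : [0,1] × [0,1] × ℝ → ℝ whose partial derivative ∂₃G with respect to the third argument exists everywhere, is continuous, and is bounded. Define F(h)(x) = h(x) − f(x) − λ ∫₀¹ G(x,t,h(t)) dt, T_{F,u}(h)(x) = u(x) − λ ∫₀¹ ∂₃G(x,t,h(t)) u(t) dt, and H₁(h)(x) = h(x) − F(h)(x)/T_{F,1}(h)(x). Assume F is 1-smooth (T_{F,1}(h)(x) ≠ 0 for all h, x) and that p ∈ C([0,1],ℝ) satisfies F(p) = 0. Then for every u ∈ C([0,1],ℝ) and every x ∈ [0,1], the limit as ε → 0 (ε ≠ 0) of (H₁(p+εu)(x) − H₁(p)(x))/ε exists and equals u(x) − T_{F,u}(p)(x)/T_{F,1}(p)(x). In particular, taking u = 1 (the constant function 1), this limit is 0 for every x ∈ [0,1]. -/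
open MeasureTheory Filter Topology

section ParametricIntegral

variable {X : Type*} [TopologicalSpace X] [CompactSpace X] [MeasurableSpace X]
  [OpensMeasurableSpace X] {μ : Measure X} [IsFiniteMeasure μ]

/-- Differentiation of a Nemytskii-type integral functional along the line `p + ε u`. -/
lemma hasDerivAt_integral_comp_add_mul {g g' : X → ℝ → ℝ}
    (hg : Continuous fun q : X × ℝ => g q.1 q.2)
    (hderiv : ∀ t y, HasDerivAt (g t) (g' t y) y)
    (hg' : Continuous fun q : X × ℝ => g' q.1 q.2)
    {M : ℝ} (hM : ∀ t y, |g' t y| ≤ M) (p u : C(X, ℝ)) :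
    HasDerivAt (fun ε : ℝ => ∫ t, g t (p t + ε * u t) ∂μ) (∫ t, g' t (p t) * u t ∂μ) 0 := by
  have hcont (ε : ℝ) : Continuous fun t => g t (p t + ε * u t) :=
    hg.comp (by fun_prop : Continuous fun t => (t, p t + ε * u t))
  have hcont' : Continuous fun t => g' t (p t + 0 * u t) * u t :=
    (hg'.comp (by fun_prop : Continuous fun t => (t, p t + 0 * u t))).mul u.continuous
  have key := (hasDerivAt_integral_of_dominated_loc_of_deriv_le (μ := μ) (x₀ := (0 : ℝ))
    (F := fun ε t => g t (p t + ε * u t)) (F' := fun ε t => g' t (p t + ε * u t) * u t)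
    (bound := fun _ => M * ‖u‖) Filter.univ_mem
    (Eventually.of_forall fun ε =>
      ((hcont ε).stronglyMeasurable_of_hasCompactSupport
        (HasCompactSupport.of_compactSpace _)).aestronglyMeasurable)
    ((hcont 0).integrable_of_hasCompactSupport (HasCompactSupport.of_compactSpace _))
    (hcont'.stronglyMeasurable_of_hasCompactSupport
      (HasCompactSupport.of_compactSpace _)).aestronglyMeasurable
    (Eventually.of_forall fun t ε _ => ?_) (integrable_const _)
    (Eventually.of_forall fun t ε _ => ?_)).2
  · simpa using key
  · rw [norm_mul, Real.norm_eq_abs]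
    exact mul_le_mul (hM _ _) (u.norm_coe_le_norm t) (norm_nonneg _)
      ((abs_nonneg _).trans (hM t 0))
  · have hline : HasDerivAt (fun ε : ℝ => p t + ε * u t) (u t) ε := by
      simpa using ((hasDerivAt_id ε).mul_const (u t)).const_add (p t)
    exact (hderiv t _).comp ε hline

/-- Continuity of an integral functional with bounded continuous kernel along `p + ε u`. -/
lemma continuous_integral_comp_add_mul {g : X → ℝ → ℝ}
    (hg : Continuous fun q : X × ℝ => g q.1 q.2)
    {M : ℝ} (hM : ∀ t y, |g t y| ≤ M) (p u : C(X, ℝ)) :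
    Continuous fun ε : ℝ => ∫ t, g t (p t + ε * u t) ∂μ := by
  refine continuous_of_dominated (bound := fun _ => M) (fun ε => ?_)
    (fun ε => Eventually.of_forall fun t => hM _ _) (integrable_const _)
    (Eventually.of_forall fun t => ?_)
  · have hcont : Continuous fun t => g t (p t + ε * u t) :=
      hg.comp (by fun_prop : Continuous fun t => (t, p t + ε * u t))
    exact (hcont.stronglyMeasurable_of_hasCompactSupport
      (HasCompactSupport.of_compactSpace _)).aestronglyMeasurable
  · exact hg.comp (by fun_prop : Continuous fun ε : ℝ => (t, p t + ε * u t))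

end ParametricIntegral

/-- If `F` is 1-smooth and `F(p) = 0`, then for every `u` and `x` the
directional derivative of the Newton operator `H₁` at `p` in direction `u`, evaluated
at `x`, exists and equals `u(x) − T_{F,u}(p)(x)/T_{F,1}(p)(x)`; in particular, for
`u = 1` this limit is `0` for every `x`. -/
theorem newton_fredholm_H_derivative_at_root
    (lam : ℝ) (f : C(Set.Icc (0:ℝ) 1, ℝ))
    (G : Set.Icc (0:ℝ) 1 → Set.Icc (0:ℝ) 1 → ℝ → ℝ)
    (G₃ : Set.Icc (0:ℝ) 1 → Set.Icc (0:ℝ) 1 → ℝ → ℝ)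
    (hG : Continuous (fun p : Set.Icc (0:ℝ) 1 × Set.Icc (0:ℝ) 1 × ℝ => G p.1 p.2.1 p.2.2))
    (hG₃ : ∀ x t y, HasDerivAt (fun z => G x t z) (G₃ x t y) y)
    (hG₃c : Continuous (fun p : Set.Icc (0:ℝ) 1 × Set.Icc (0:ℝ) 1 × ℝ => G₃ p.1 p.2.1 p.2.2))
    (hG₃b : ∃ M : ℝ, ∀ x t y, |G₃ x t y| ≤ M)
    (F : C(Set.Icc (0:ℝ) 1, ℝ) → Set.Icc (0:ℝ) 1 → ℝ)
    (T : C(Set.Icc (0:ℝ) 1, ℝ) → C(Set.Icc (0:ℝ) 1, ℝ) → Set.Icc (0:ℝ) 1 → ℝ)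
    (H₁ : C(Set.Icc (0:ℝ) 1, ℝ) → Set.Icc (0:ℝ) 1 → ℝ)
    (hF : ∀ h x, F h x = h x - f x - lam * ∫ t : Set.Icc (0:ℝ) 1, G x t (h t))
    (hT : ∀ u h x, T u h x = u x - lam * ∫ t : Set.Icc (0:ℝ) 1, G₃ x t (h t) * u t)
    (hsmooth : ∀ h x, T 1 h x ≠ 0)
    (hH₁ : ∀ h x, H₁ h x = h x - F h x / T 1 h x)
    (p : C(Set.Icc (0:ℝ) 1, ℝ)) (hp : ∀ x, F p x = 0) :
    (∀ (u : C(Set.Icc (0:ℝ) 1, ℝ)) (x : Set.Icc (0:ℝ) 1),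
        Tendsto (fun ε : ℝ => (H₁ (p + ε • u) x - H₁ p x) / ε) (𝓝[≠] 0)
          (𝓝 (u x - T u p x / T 1 p x))) ∧
    (∀ x : Set.Icc (0:ℝ) 1,
        Tendsto (fun ε : ℝ => (H₁ (p + ε • (1 : C(Set.Icc (0:ℝ) 1, ℝ))) x - H₁ p x) / ε)
          (𝓝[≠] 0) (𝓝 0)) := by
  obtain ⟨M, hM⟩ := hG₃b
  have main (u : C(Set.Icc (0:ℝ) 1, ℝ)) (x : Set.Icc (0:ℝ) 1) :
      Tendsto (fun ε : ℝ => (H₁ (p + ε • u) x - H₁ p x) / ε) (𝓝[≠] 0)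
        (𝓝 (u x - T u p x / T 1 p x)) := by
    have hGx : Continuous fun q : Set.Icc (0:ℝ) 1 × ℝ => G x q.1 q.2 :=
      hG.comp (by fun_prop : Continuous fun q : Set.Icc (0:ℝ) 1 × ℝ => (x, q.1, q.2))
    have hG₃x : Continuous fun q : Set.Icc (0:ℝ) 1 × ℝ => G₃ x q.1 q.2 :=
      hG₃c.comp (by fun_prop : Continuous fun q : Set.Icc (0:ℝ) 1 × ℝ => (x, q.1, q.2))
    have hF' : HasDerivAt (fun ε : ℝ => F (p + ε • u) x) (T u p x) 0 := by
      have hint := hasDerivAt_integral_comp_add_mul (μ := volume) hGx (hG₃ x) hG₃x (hM x) p u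
      have hline : HasDerivAt (fun ε : ℝ => p x + ε * u x - f x) (u x) 0 := by
        simpa using (((hasDerivAt_id (0:ℝ)).mul_const (u x)).const_add (p x)).sub_const (f x)
      simp only [hF, hT]
      exact hline.sub (hint.const_mul lam)
    have hT' : Tendsto (fun ε : ℝ => T 1 (p + ε • u) x) (𝓝[≠] 0) (𝓝 (T 1 p x)) := by
      have hcont : Continuous fun ε : ℝ => T 1 (p + ε • u) x := by
        have hint := continuous_integral_comp_add_mul (μ := volume) hG₃x (hM x) p u
        simp only [hT, ContinuousMap.one_apply, mul_one]
        exact continuous_const.sub (hint.const_mul lam)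
      simpa using (hcont.tendsto 0).mono_left nhdsWithin_le_nhds
    have hslope : Tendsto (fun ε : ℝ => F (p + ε • u) x / ε) (𝓝[≠] 0) (𝓝 (T u p x)) := by
      simpa [hp, div_eq_inv_mul] using hF'.tendsto_slope_zero
    refine (tendsto_const_nhds.sub (hslope.div hT' (hsmooth p x))).congr' ?_
    filter_upwards [self_mem_nhdsWithin] with ε hε
    have hε : ε ≠ 0 := hε
    have hTε := hsmooth (p + ε • u) x
    simp only [hH₁, hp, ContinuousMap.add_apply, ContinuousMap.smul_apply, smul_eq_mul]
    simp only [Pi.div_apply]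
    field_simp
    ring
  exact ⟨main, fun x => by simpa [div_self (hsmooth p x)] using main 1 x⟩
end

section
/- For the operator F associated with Example 2, F is 1-smooth: for every continuous function h : [0,1] → ℝ and every x ∈ [0,1], one has T_{F,1}(h)(x) = 1 − (1/2)x·∫₀¹ eᵗ·cos(h(t)) dt ≥ 1 − (e − 1)/2 = (3 − e)/2 > 0; in particular T_{F,1}(h)(x) ≠ 0. -/
open MeasureTheory

theorem integral_Icc_exp_mul_cos_le (h : C(Set.Icc (0:ℝ) 1, ℝ)) :
    ∫ t : Set.Icc (0:ℝ) 1, Real.exp t * Real.cos (h t) ≤ Real.exp 1 - 1 := by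
  have integrable_of_continuous {f : Set.Icc (0:ℝ) 1 → ℝ} (hf : Continuous f) :
      Integrable f := hf.integrable_of_hasCompactSupport (HasCompactSupport.of_compactSpace f)
  calc ∫ t : Set.Icc (0:ℝ) 1, Real.exp t * Real.cos (h t)
      ≤ ∫ t : Set.Icc (0:ℝ) 1, Real.exp t := by
        refine integral_mono (integrable_of_continuous (by fun_prop))
          (integrable_of_continuous (by fun_prop)) fun t => ?_
        exact mul_le_of_le_one_right (Real.exp_pos _).le (Real.cos_le_one _)
    _ = ∫ t in (0:ℝ)..1, Real.exp t := by
        rw [intervalIntegral.integral_of_le zero_le_one, ← integral_Icc_eq_integral_Ioc]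
        exact integral_subtype_comap measurableSet_Icc Real.exp
    _ = Real.exp 1 - 1 := by simp

/-- Example 2 is 1-smooth. For every continuous `h : [0,1] → ℝ`
and every `x ∈ [0,1]`,
`T_{F,1}(h)(x) = 1 − (1/2)x ∫₀¹ eᵗ cos(h(t)) dt ≥ 1 − (e−1)/2 = (3−e)/2 > 0`;
in particular `T_{F,1}(h)(x) ≠ 0`. -/
theorem example2_one_smooth
    (T₁ : C(Set.Icc (0:ℝ) 1, ℝ) → Set.Icc (0:ℝ) 1 → ℝ)
    (hT₁ : ∀ h x, T₁ h x =
      1 - (1 / 2) * (x : ℝ) * ∫ t : Set.Icc (0:ℝ) 1, Real.exp t * Real.cos (h t)) :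
    ∀ (h : C(Set.Icc (0:ℝ) 1, ℝ)) (x : Set.Icc (0:ℝ) 1),
      (3 - Real.exp 1) / 2 ≤ T₁ h x ∧
      1 - (Real.exp 1 - 1) / 2 = (3 - Real.exp 1) / 2 ∧
      (0:ℝ) < (3 - Real.exp 1) / 2 ∧
      T₁ h x ≠ 0 := by
  intro h x
  have hlt : Real.exp 1 < 3 := Real.exp_one_lt_three
  have hge : (1:ℝ) ≤ Real.exp 1 := Real.one_le_exp zero_le_one
  have hx : (x : ℝ) * ∫ t : Set.Icc (0:ℝ) 1, Real.exp t * Real.cos (h t) ≤ Real.exp 1 - 1 :=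
    (mul_le_mul_of_nonneg_left (integral_Icc_exp_mul_cos_le h) x.2.1).trans
      (mul_le_of_le_one_left (by linarith) x.2.2)
  have hT : (3 - Real.exp 1) / 2 ≤ T₁ h x := by
    rw [hT₁, mul_assoc]
    linarith
  have hpos : (0:ℝ) < (3 - Real.exp 1) / 2 := by linarith
  exact ⟨hT, by ring, hpos, (hpos.trans_le hT).ne'⟩
end
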